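/- As n → ∞, the quantity 2n·H(n) − [ n·H(2n) − n·(H(2n) − 1)/(2(2n − 1)) ] − [ n·log n − (log 2 − γ)·n + (n·log n)/(2(2n−1)) + n·(log 2 + γ − 1)/(2(2n−1)) + 3/4 ] tends to 0. (Equivalently, m(n,n) = 2nH(n) − M(n,n) admits the asymptotic expansion n log n − (log 2 − γ)n + (n log n)/(2(2n−1)) + n(log 2 + γ − 1)/(2(2n−1)) + 3/4 + o(1).) -/

import Mathlib

open Filter Real

/-- The `m`-th harmonic number `∑_{i=1}^m 1/i`, as a real number. -/
noncomputable def H (m : ℕ) : ℝ := ∑ i ∈ Finset.range m, (1 : ℝ) / (i + 1)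

lemma log_up (n : ℕ) (hn : 1 ≤ n) :
    Real.log ((n : ℝ) + 1) - Real.log n ≤ (1 / (n : ℝ) + 1 / ((n : ℝ) + 1)) / 2 := by
  have h0 : (0 : ℝ) < n := by exact_mod_cast hn
  have hy : (0 : ℝ) < ((n : ℝ) + 1) / n := by positivity
  have hl : 0 ≤ Real.log (((n : ℝ) + 1) / n) := by
    apply Real.log_nonneg
    rw [le_div_iff₀ h0]; linarith
  have h := Real.self_le_sinh_iff.mpr hl
  rw [Real.sinh_log hy, Real.log_div (by positivity) (by positivity)] at h
  refine h.trans (le_of_eq ?_)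
  field_simp
  ring

lemma log_lo (n : ℕ) (hn : 1 ≤ n) :
    1 / ((n : ℝ) + 1) + 1 / (2 * ((n : ℝ) + 1)) - 1 / (2 * ((n : ℝ) + 2)) ≤
      Real.log ((n : ℝ) + 1) - Real.log n := by
  have h0 : (0 : ℝ) < n := by exact_mod_cast hn
  have h := Real.le_log_one_add_of_nonneg (x := 1 / (n : ℝ)) (by positivity)
  have e : 1 + 1 / (n : ℝ) = ((n : ℝ) + 1) / n := by field_simp
  rw [e, Real.log_div (by positivity) (by positivity)] at h
  refine le_trans ?_ h
  have e2 : 2 * (1 / (n : ℝ)) / (1 / (n : ℝ) + 2) -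
      (1 / ((n : ℝ) + 1) + 1 / (2 * ((n : ℝ) + 1)) - 1 / (2 * ((n : ℝ) + 2))) =
      3 / (2 * (n + 1) * (n + 2) * (2 * n + 1)) := by
    field_simp
    ring
  have : (0 : ℝ) ≤ 3 / (2 * (n + 1) * (n + 2) * (2 * n + 1)) := by positivity
  linarith

lemma H_succ (n : ℕ) : H (n + 1) = H n + 1 / ((n : ℝ) + 1) := by
  simp [H, Finset.sum_range_succ]

lemma D_tendsto : Tendsto (fun n : ℕ => H n - Real.log n - eulerMascheroniConstant)
    atTop (nhds 0) := by
  have h := Real.tendsto_harmonic_sub_log.sub_const eulerMascheroniConstant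
  rw [sub_self] at h
  refine h.congr fun n => ?_
  simp [H, harmonic]

lemma D_up (n : ℕ) (hn : 1 ≤ n) :
    H n - Real.log n - eulerMascheroniConstant ≤ 1 / (2 * (n : ℝ)) := by
  let a : ℕ → ℝ := fun k => H (k + 1) - Real.log ((k + 1 : ℕ) : ℝ) - eulerMascheroniConstant
    - (1 / 2) * (1 / (((k : ℕ) : ℝ) + 1))
  have hm : Monotone a := by
    refine monotone_nat_of_le_succ fun k => ?_
    have h := log_up (k + 1) (by omega)
    simp only [a]
    rw [H_succ (k + 1)]
    push_cast at h ⊢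
    linarith
  have ht : Tendsto a atTop (nhds 0) := by
    have h1 := (tendsto_add_atTop_iff_nat 1).mpr D_tendsto
    have h2 := (tendsto_one_div_add_atTop_nhds_zero_nat (𝕜 := ℝ)).const_mul (1 / 2)
    simpa [a] using h1.sub h2
  have := hm.ge_of_tendsto ht (n - 1)
  obtain ⟨k, rfl⟩ : ∃ k, n = k + 1 := ⟨n - 1, by omega⟩
  simp only [a, Nat.add_sub_cancel] at this
  have e : 1 / (2 * ((k + 1 : ℕ) : ℝ)) = (1 / 2) * (1 / ((k : ℝ) + 1)) := by
    push_cast; field_simp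
  rw [e]; linarith

lemma D_lo (n : ℕ) (hn : 1 ≤ n) :
    1 / (2 * ((n : ℝ) + 1)) ≤ H n - Real.log n - eulerMascheroniConstant := by
  let a : ℕ → ℝ := fun k => H (k + 1) - Real.log ((k + 1 : ℕ) : ℝ) - eulerMascheroniConstant
    - (1 / 2) * (1 / (((k + 1 : ℕ) : ℝ) + 1))
  have hm : Antitone a := by
    refine antitone_nat_of_succ_le fun k => ?_
    have h := log_lo (k + 1) (by omega)
    simp only [a]
    rw [H_succ (k + 1)]
    rw [← one_div_mul_one_div, ← one_div_mul_one_div] at h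
    push_cast at h ⊢
    rw [show (k : ℝ) + 1 + 2 = k + 1 + 1 + 1 by ring] at h
    linarith
  have ht : Tendsto a atTop (nhds 0) := by
    have h1 := (tendsto_add_atTop_iff_nat 1).mpr D_tendsto
    have h2 := ((tendsto_add_atTop_iff_nat 1).mpr
      (tendsto_one_div_add_atTop_nhds_zero_nat (𝕜 := ℝ))).const_mul (1 / 2)
    simpa [a] using h1.sub h2
  have := hm.le_of_tendsto ht (n - 1)
  obtain ⟨k, rfl⟩ : ∃ k, n = k + 1 := ⟨n - 1, by omega⟩
  simp only [a, Nat.add_sub_cancel] at this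
  rw [← one_div_mul_one_div]; linarith

lemma E_tendsto : Tendsto (fun n : ℕ => (n : ℝ) * (H n - Real.log n - eulerMascheroniConstant))
    atTop (nhds (1 / 2)) := by
  have h2 := ((tendsto_one_div_add_atTop_nhds_zero_nat (𝕜 := ℝ)).const_mul (1 / 2)).const_sub (1 / 2)
  rw [mul_zero, sub_zero] at h2
  refine tendsto_of_tendsto_of_tendsto_of_le_of_le' h2 tendsto_const_nhds ?_ ?_
  · filter_upwards [eventually_ge_atTop 1] with n hn
    have h0 : (0 : ℝ) < n := by exact_mod_cast hn
    have := mul_le_mul_of_nonneg_left (D_lo n hn) h0.le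
    refine le_trans (le_of_eq ?_) this
    field_simp
    ring
  · filter_upwards [eventually_ge_atTop 1] with n hn
    have h0 : (0 : ℝ) < n := by exact_mod_cast hn
    have := mul_le_mul_of_nonneg_left (D_up n hn) h0.le
    refine this.trans (le_of_eq ?_)
    field_simp

/-- The asymptotic expansion of the expected completion time of the faster of two
coupon collectors: `m(n,n) = 2nH(n) − M(n,n)` where
`M(n,n) = nH(2n) − n(H(2n)−1)/(2(2n−1))`, and
`m(n,n) = n log n − (log 2 − γ)n + (n log n)/(2(2n−1)) + n(log 2 + γ − 1)/(2(2n−1)) + 3/4 + o(1)`. -/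
theorem faster_two_players_asymptotics :
    Tendsto (fun n : ℕ =>
        (2 * (n : ℝ) * H n -
            ((n : ℝ) * H (2 * n) - (n : ℝ) * (H (2 * n) - 1) / (2 * (2 * (n : ℝ) - 1)))) -
          ((n : ℝ) * Real.log n - (Real.log 2 - eulerMascheroniConstant) * n +
            ((n : ℝ) * Real.log n) / (2 * (2 * (n : ℝ) - 1)) +
            (n : ℝ) * (Real.log 2 + eulerMascheroniConstant - 1) / (2 * (2 * (n : ℝ) - 1)) +
            3 / 4))
      atTop (nhds 0) := by
  have hd : Tendsto (fun n : ℕ => 2 * n) atTop atTop :=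
    tendsto_id.const_mul_atTop' (by norm_num)
  have hE2 := E_tendsto.comp hd
  have hinv : Tendsto (fun n : ℕ => (2 * (2 * (n : ℝ) - 1))⁻¹) atTop (nhds 0) := by
    apply Tendsto.inv_tendsto_atTop
    apply Tendsto.const_mul_atTop (by norm_num)
    apply tendsto_atTop_add_const_right
    exact tendsto_natCast_atTop_atTop.const_mul_atTop (by norm_num)
  have key := (((E_tendsto.const_mul 2).sub (hE2.const_mul (1 / 2))).add
    ((hE2.const_mul (1 / 2)).mul hinv)).sub_const (3 / 4)
  have e : (2 * (1 / 2) - 1 / 2 * (1 / 2) + 1 / 2 * (1 / 2) * 0 - 3 / 4 : ℝ) = 0 := by norm_num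
  rw [e] at key
  refine key.congr' ?_
  filter_upwards [eventually_ge_atTop 1] with n hn
  have h0 : (0 : ℝ) < n := by exact_mod_cast hn
  have hl : Real.log (2 * (n : ℝ)) = Real.log 2 + Real.log n :=
    Real.log_mul (by norm_num) h0.ne'
  simp only [Function.comp]
  push_cast
  rw [hl]
  simp only [div_eq_mul_inv _ (2 * (2 * (n : ℝ) - 1))]
  ring
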